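/- Let G be a group, θ : G → G a group homomorphism, and u : ℤ → G with u_n = e for n ≥ 1, and let t be a Hausdorff topology on the Warne semigroup B_W for which the multiplication of B_W is separately continuous. Suppose the set G_{0,0} = {0} × G × {0} is compact in (B_W,t). Then: (i) t equals the product topology on ℤ × G × ℤ in which both copies of ℤ carry the discrete topology and G carries the topology induced from (B_W,t) by g ↦ (0,g,0); and (ii) (B_W,t) is locally compact, the multiplication of B_W is jointly continuous with respect to t, and there is a t-continuous map inv : B_W → B_W with x·inv(x)·x = x and inv(x)·x·inv(x) = inv(x) for all x ∈ B_W. -/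

import Mathlib

/-- The elements `f_{m,n}` of the Warne construction:
`f_{0,n} = e` and `f_{m,n} = θ^{m-1}(u_{n+1}) ⬝ θ^{m-2}(u_{n+2}) ⬝ … ⬝ u_{n+m}`. -/
def warneF {G : Type*} [Group G] (θ : Monoid.End G) (u : ℤ → G) : ℕ → ℤ → G
  | 0, _ => 1
  | m + 1, n => (θ ^ m) (u (n + 1)) * warneF θ u m (n + 1)

/-- The multiplication of the Warne semigroup `B_W` on `ℤ × G × ℤ`:
`(a,g,b)·(c,h,d) = (a, g·f_{b−c,c}⁻¹·θ^{b−c}(h)·f_{b−c,d}, d−c+b)` if `b ≥ c`, and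
`(a−b+c, f_{c−b,a}⁻¹·θ^{c−b}(g)·f_{c−b,b}·h, d)` if `b ≤ c`. -/
def warneMul {G : Type*} [Group G] (θ : Monoid.End G) (u : ℤ → G) :
    ℤ × G × ℤ → ℤ × G × ℤ → ℤ × G × ℤ :=
  fun x y =>
    if y.1 ≤ x.2.2 then
      (x.1,
        x.2.1 * (warneF θ u (x.2.2 - y.1).toNat y.1)⁻¹ *
          (θ ^ (x.2.2 - y.1).toNat) y.2.1 * warneF θ u (x.2.2 - y.1).toNat y.2.2,
        y.2.2 - y.1 + x.2.2)
    else
      (x.1 - x.2.2 + y.1,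
        (warneF θ u (y.1 - x.2.2).toNat x.1)⁻¹ *
          (θ ^ (y.1 - x.2.2).toNat) x.2.1 * warneF θ u (y.1 - x.2.2).toNat x.2.2 * y.2.1,
        y.2.2)

open Topology Set Filter

/-- Stone–Weierstrass without separation of points: a continuous function that is constant on the
common fibres of a subalgebra is a uniform limit of elements of the subalgebra. -/
theorem Subalgebra.mem_topologicalClosure_of_forall_fiber {Y : Type*} [TopologicalSpace Y]
    [CompactSpace Y] (A : Subalgebra ℝ C(Y, ℝ)) (f : C(Y, ℝ))
    (hf : ∀ y y', (∀ g ∈ A, g y = g y') → f y = f y') : f ∈ A.topologicalClosure := by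
  let ev : Y → A → ℝ := fun y g => g.1 y
  have hev : Continuous ev := continuous_pi fun g => g.1.continuous
  let π : C(Y, range ev) := ⟨rangeFactorization ev, hev.subtype_mk _⟩
  have hπ : Function.Surjective π := rangeFactorization_surjective
  have : CompactSpace (range ev) := isCompact_iff_compactSpace.mp (isCompact_range hev)
  have hq : IsQuotientMap π := π.continuous.isClosedMap.isQuotientMap π.continuous hπ
  let B : Subalgebra ℝ C(range ev, ℝ) :=
    A.topologicalClosure.comap (ContinuousMap.compRightAlgHom ℝ ℝ π)
  have hBclosed : IsClosed (B : Set C(range ev, ℝ)) :=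
    A.isClosed_topologicalClosure.preimage (ContinuousMap.compRightAlgHom_continuous ℝ ℝ π)
  have hBsep : B.SeparatesPoints := by
    intro p q hpq
    obtain ⟨g, hg⟩ := Function.ne_iff.mp (fun h => hpq (Subtype.ext h))
    refine ⟨fun r => r.1 g, ⟨⟨fun r => r.1 g, (continuous_apply g).comp continuous_subtype_val⟩, ?_, rfl⟩, hg⟩
    exact A.le_topologicalClosure g.2
  have hB : B = ⊤ := by
    rw [← ContinuousMap.subalgebra_topologicalClosure_eq_top_of_separatesPoints B hBsep]
    exact le_antisymm B.le_topologicalClosure (B.topologicalClosure_minimal le_rfl hBclosed)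
  have hfac : ∀ y y', π y = π y' → f y = f y' := fun y y' h =>
    hf y y' fun g hg => congr_fun (congr_arg Subtype.val h) ⟨g, hg⟩
  have hmem : hq.lift f hfac ∈ B := hB ▸ Algebra.mem_top
  have hlift : (hq.lift f hfac).comp π = f := hq.lift_comp f hfac
  have := Subalgebra.mem_comap _ _ _ |>.mp hmem
  rwa [ContinuousMap.compRightAlgHom_apply, hlift] at this

section NormOscillation

variable {X Y : Type*} [TopologicalSpace X] [TopologicalSpace Y] [CompactSpace Y]

theorem isOpen_setOf_lt_dist_of_pointwise {φ : X → C(Y, ℝ)} (hφ : ∀ y, Continuous fun x => φ x y)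
    {δ : ℝ} (hδ : 0 ≤ δ) (ψ : C(Y, ℝ)) : IsOpen {x | δ < dist (φ x) ψ} := by
  have : {x | δ < dist (φ x) ψ} = ⋃ y, {x | δ < dist (φ x y) (ψ y)} := by
    ext x
    simp only [mem_ofPred_eq, mem_iUnion]
    rw [← not_le, ContinuousMap.dist_le hδ]
    push Not
    rfl
  rw [this]
  exact isOpen_iUnion fun y => isOpen_lt continuous_const ((hφ y).dist continuous_const)

/-- If the image of every nonempty open set has large diameter, then one can shrink open sets so
that their images avoid neighbourhoods of finitely many prescribed functions. -/
theorem exists_isOpen_subset_forall_lt_dist {φ : X → C(Y, ℝ)}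
    (hφ : ∀ y, Continuous fun x => φ x y) {δ : ℝ} (hδ : 0 ≤ δ)
    (hosc : ∀ U : Set X, IsOpen U → U.Nonempty → ∃ x ∈ U, ∃ x' ∈ U, 2 * δ < dist (φ x) (φ x'))
    (L : Finset C(Y, ℝ)) {U : Set X} (hU : IsOpen U) (hne : U.Nonempty) :
    ∃ V ⊆ U, IsOpen V ∧ V.Nonempty ∧ ∀ x ∈ V, ∀ ψ ∈ L, δ < dist (φ x) ψ := by
  classical
  induction L using Finset.induction_on with
  | empty => exact ⟨U, Subset.rfl, hU, hne, by simp⟩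
  | insert ψ L _ ih =>
    obtain ⟨V, hVU, hV, hVne, hVL⟩ := ih
    refine ⟨V ∩ {x | δ < dist (φ x) ψ}, inter_subset_left.trans hVU,
      hV.inter (isOpen_setOf_lt_dist_of_pointwise hφ hδ ψ), ?_, ?_⟩
    · obtain ⟨x, hx, x', hx', h⟩ := hosc V hV hVne
      by_contra hempty
      rw [not_nonempty_iff_eq_empty, eq_empty_iff_forall_notMem] at hempty
      have h₁ : dist (φ x) ψ ≤ δ := not_lt.mp fun hlt => hempty x ⟨hx, hlt⟩
      have h₂ : dist (φ x') ψ ≤ δ := not_lt.mp fun hlt => hempty x' ⟨hx', hlt⟩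
      linarith [dist_triangle_right (φ x) (φ x') ψ]
    · rintro x ⟨hxV, hxψ⟩ χ hχ
      obtain rfl | hχ := Finset.mem_insert.mp hχ
      exacts [hxψ, hVL x hxV χ hχ]

open Classical in
/-- One step in building up a countable dense subset of a subalgebra of `C(Y, ℝ)` from finite
sets. -/
noncomputable def extendFinset (L : Finset C(Y, ℝ)) (f : C(Y, ℝ)) (r : ℝ) :
    Finset C(Y, ℝ) :=
  insert f (insert (algebraMap ℝ C(Y, ℝ) r)
    (L ∪ Finset.image₂ (· + ·) L L ∪ Finset.image₂ (· * ·) L L))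

theorem adjoin_subset_closure_of_extendFinset {L : ℕ → Finset C(Y, ℝ)} {f : ℕ → C(Y, ℝ)}
    (hL : ∀ n, L (n + 1) = extendFinset (L n) (f n) (TopologicalSpace.denseSeq ℝ n)) :
    (Algebra.adjoin ℝ (range f) : Set C(Y, ℝ)) ⊆ closure (⋃ n, (L n : Set C(Y, ℝ))) := by
  classical
  have hmono : Monotone L := monotone_nat_of_le_succ fun n g hg => by
    rw [hL]; simp [extendFinset, hg]
  have hadd : ∀ g ∈ ⋃ n, (L n : Set C(Y, ℝ)), ∀ h ∈ ⋃ n, (L n : Set C(Y, ℝ)),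
      g + h ∈ ⋃ n, (L n : Set C(Y, ℝ)) := by
    simp only [mem_iUnion, Finset.mem_coe]
    rintro g ⟨m, hg⟩ h ⟨n, hh⟩
    refine ⟨max m n + 1, ?_⟩
    rw [hL]
    have := Finset.mem_image₂_of_mem (f := (· + ·)) (hmono (le_max_left m n) hg)
      (hmono (le_max_right m n) hh)
    simp only [extendFinset, Finset.mem_insert, Finset.mem_union]
    tauto
  have hmul : ∀ g ∈ ⋃ n, (L n : Set C(Y, ℝ)), ∀ h ∈ ⋃ n, (L n : Set C(Y, ℝ)),
      g * h ∈ ⋃ n, (L n : Set C(Y, ℝ)) := by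
    simp only [mem_iUnion, Finset.mem_coe]
    rintro g ⟨m, hg⟩ h ⟨n, hh⟩
    refine ⟨max m n + 1, ?_⟩
    rw [hL]
    have := Finset.mem_image₂_of_mem (f := (· * ·)) (hmono (le_max_left m n) hg)
      (hmono (le_max_right m n) hh)
    simp only [extendFinset, Finset.mem_insert, Finset.mem_union]
    tauto
  intro g hg
  induction hg using Algebra.adjoin_induction with
  | mem g hg =>
    obtain ⟨n, rfl⟩ := hg
    exact subset_closure (mem_iUnion.mpr ⟨n + 1, by rw [hL]; simp [extendFinset]⟩)
  | algebraMap r =>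
    have hr : r ∈ closure (range (TopologicalSpace.denseSeq ℝ)) :=
      TopologicalSpace.denseRange_denseSeq ℝ r
    refine map_mem_closure (continuous_algebraMap ℝ C(Y, ℝ)) hr ?_
    rintro _ ⟨n, rfl⟩
    exact mem_iUnion.mpr ⟨n + 1, by rw [hL]; simp [extendFinset]⟩
  | add g h _ _ hg hh => exact map_mem_closure₂ continuous_add hg hh hadd
  | mul g h _ _ hg hh => exact map_mem_closure₂ continuous_mul hg hh hmul

/-- A pointwise continuous map from a compact space to `C(Y, ℝ)` has small norm oscillation on
some nonempty open set (a weak form of Namioka's theorem). -/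
theorem exists_isOpen_forall_dist_le_of_pointwise [CompactSpace X] [RegularSpace X] [Nonempty X]
    {φ : X → C(Y, ℝ)} (hφ : ∀ y, Continuous fun x => φ x y) {ε : ℝ} (hε : 0 < ε) :
    ∃ U : Set X, IsOpen U ∧ U.Nonempty ∧ ∀ x ∈ U, ∀ x' ∈ U, dist (φ x) (φ x') ≤ ε := by
  by_contra! hosc
  have hδ : 0 < ε / 2 := half_pos hε
  have hosc' : ∀ U : Set X, IsOpen U → U.Nonempty →
      ∃ x ∈ U, ∃ x' ∈ U, 2 * (ε / 2) < dist (φ x) (φ x') := by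
    simpa only [mul_div_cancel₀ ε (two_ne_zero' ℝ)] using hosc
  let State := {U : Set X // IsOpen U ∧ U.Nonempty} × Finset C(Y, ℝ)
  have step : ∀ (n : ℕ) (s : State), ∃ (x : X) (s' : State), x ∈ s.1.1 ∧
      closure s'.1.1 ⊆ s.1.1 ∧
      s'.2 = extendFinset s.2 (φ x) (TopologicalSpace.denseSeq ℝ n) ∧
      ∀ z ∈ s'.1.1, ∀ ψ ∈ s'.2, ε / 2 < dist (φ z) ψ := by
    rintro n ⟨⟨U, hU, x, hx⟩, L⟩
    obtain ⟨C, hCx, hC, hCU⟩ := exists_mem_nhds_isClosed_subset (hU.mem_nhds hx)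
    obtain ⟨V, hVC, hV, hVne, hVL⟩ := exists_isOpen_subset_forall_lt_dist hφ hδ.le hosc'
      (extendFinset L (φ x) (TopologicalSpace.denseSeq ℝ n)) isOpen_interior
      ⟨x, mem_interior_iff_mem_nhds.mpr hCx⟩
    exact ⟨x, ⟨⟨V, hV, hVne⟩, _⟩, hx,
      (closure_minimal (hVC.trans interior_subset) hC).trans hCU, rfl, hVL⟩
  choose pt next hpt hcl hL hdist using step
  let s : ℕ → State := fun n => Nat.rec ⟨⟨univ, isOpen_univ, univ_nonempty⟩, ∅⟩ next n
  have hanti : Antitone fun n => (s n).1.1 :=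
    antitone_nat_of_succ_le fun n => subset_closure.trans (hcl n (s n))
  let x : ℕ → X := fun n => pt n (s n)
  obtain ⟨a, ha⟩ := exists_clusterPt_of_compactSpace (map x atTop)
  have haU : ∀ n, a ∈ (s n).1.1 := fun n => by
    refine hcl n (s n) (ha.mono ?_).mem_closure
    rw [le_principal_iff, mem_map]
    exact (eventually_ge_atTop (n + 1)).mono fun m hm => hanti hm (hpt m (s m))
  have hax : a ∈ closure (range x) :=
    (ha.mono (le_principal_iff.mpr (range_mem_map))).mem_closure
  have hmem : φ a ∈ (Algebra.adjoin ℝ (range fun n => φ (x n))).topologicalClosure := by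
    refine Subalgebra.mem_topologicalClosure_of_forall_fiber _ _ fun y y' hyy' => ?_
    have hclosed : IsClosed {z | φ z y = φ z y'} := isClosed_eq (hφ y) (hφ y')
    refine closure_minimal ?_ hclosed hax
    rintro _ ⟨n, rfl⟩
    exact hyy' _ (Algebra.subset_adjoin ⟨n, rfl⟩)
  have hmem' : φ a ∈ closure (⋃ n, ((s n).2 : Set C(Y, ℝ))) :=
    closure_minimal (adjoin_subset_closure_of_extendFinset fun n => hL n (s n)) isClosed_closure
      hmem
  obtain ⟨ψ, hψ, hlt⟩ := Metric.mem_closure_iff.mp hmem' (ε / 2) hδ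
  obtain ⟨n, hn⟩ := mem_iUnion.mp hψ
  cases n with
  | zero => simp [s] at hn
  | succ n => exact lt_asymm hlt (hdist n (s n) a (haU (n + 1)) ψ hn)

end NormOscillation

/-- **Ellis' theorem** for compact groups: separately continuous multiplication is jointly
continuous. -/
theorem continuousMul_of_compact_of_separatelyContinuousMul {G : Type*} [Group G]
    [TopologicalSpace G] [CompactSpace G] [T2Space G] [SeparatelyContinuousMul G] :
    ContinuousMul G := by
  refine ⟨continuous_iff_continuousAt.mpr ?_⟩
  rintro ⟨x₀, y₀⟩ N hN
  obtain ⟨O, hON, hO, hxyO⟩ := mem_nhds_iff.mp hN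
  obtain ⟨f, hf0, hf1, -⟩ := exists_continuous_zero_one_of_isClosed
    (isClosed_singleton (x := x₀ * y₀)) hO.isClosed_compl
    (disjoint_singleton_left.mpr fun h => h hxyO)
  have hf0 : f (x₀ * y₀) = 0 := hf0 rfl
  let φ : G → C(G, ℝ) := fun x => ⟨fun y => f (x * y), f.continuous.comp (continuous_const_mul x)⟩
  obtain ⟨U, hU, ⟨a, ha⟩, hosc⟩ := exists_isOpen_forall_dist_le_of_pointwise (φ := φ)
    (fun y => f.continuous.comp (continuous_mul_const y)) (ε := 1 / 4) (by norm_num)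
  have hx : ∀ᶠ x in 𝓝 x₀, x * (x₀⁻¹ * a) ∈ U :=
    (continuous_mul_const (x₀⁻¹ * a)).continuousAt.eventually_mem
      (hU.mem_nhds (by simpa using ha))
  have hy : ∀ᶠ y in 𝓝 y₀, f (x₀ * y) < 1 / 4 :=
    (f.continuous.comp (continuous_const_mul x₀)).continuousAt.eventually_lt
      continuousAt_const (by simp [hf0])
  rw [mem_map, nhds_prod_eq]
  filter_upwards [hx.prod_mk hy] with ⟨x, y⟩ ⟨hx, hy⟩
  refine hON (by_contra fun hxy => ?_)
  have h1 : f (x * y) = 1 := hf1 hxy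
  have h := (ContinuousMap.dist_apply_le_dist (a⁻¹ * x₀ * y)).trans (hosc _ hx a ha)
  have e₁ : φ (x * (x₀⁻¹ * a)) (a⁻¹ * x₀ * y) = f (x * y) := congr_arg f (by group)
  have e₂ : φ a (a⁻¹ * x₀ * y) = f (x₀ * y) := congr_arg f (by group)
  rw [e₁, e₂, h1, Real.dist_eq] at h
  linarith [le_abs_self (1 - f (x₀ * y))]

theorem isTopologicalGroup_of_compact_of_separatelyContinuousMul {G : Type*} [Group G]
    [TopologicalSpace G] [CompactSpace G] [T2Space G] [SeparatelyContinuousMul G] :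
    IsTopologicalGroup G := by
  have : ContinuousMul G := continuousMul_of_compact_of_separatelyContinuousMul
  let e : G × G ≃ G × G := (Equiv.refl G).prodShear Equiv.mulLeft
  have he : Continuous e := continuous_fst.prodMk continuous_mul
  refine { continuous_inv := ?_ }
  have h : Continuous fun x : G => (he.homeoOfEquivCompactToT2.symm (x, 1)).2 := by fun_prop
  exact h.congr fun x => mul_one x⁻¹

section Warne

variable {G : Type*} [Group G] {θ : Monoid.End G} {u : ℤ → G}

@[simp]
theorem warneF_zero (n : ℤ) : warneF θ u 0 n = 1 := rfl

theorem warneF_eq_one (hu : ∀ n : ℤ, 1 ≤ n → u n = 1) (m : ℕ) {n : ℤ} (hn : 0 ≤ n) :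
    warneF θ u m n = 1 := by
  induction m generalizing n with
  | zero => rfl
  | succ m ih => simp [warneF, hu (n + 1) (by lia), ih (n := n + 1) (by lia)]

theorem warneMul_of_eq (a : ℤ) (g : G) (b : ℤ) (h : G) (d : ℤ) :
    warneMul θ u (a, g, b) (b, h, d) = (a, g * h, d) := by
  simp [warneMul]

theorem warneMul_idem_left_of_le {i : ℤ} {x : ℤ × G × ℤ} (h : i ≤ x.1) :
    warneMul θ u (i, 1, i) x = x := by
  obtain ⟨a, g, b⟩ := x
  obtain rfl | h : i = a ∨ i < a := eq_or_lt_of_le h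
  · simp [warneMul_of_eq]
  · simp [warneMul, not_le.mpr h]

theorem warneMul_idem_right_of_le {j : ℤ} {x : ℤ × G × ℤ} (h : j ≤ x.2.2) :
    warneMul θ u x (j, 1, j) = x := by
  obtain ⟨a, g, b⟩ := x
  simp_all [warneMul]

theorem warneMul_idem_left_of_ge {i : ℤ} {x : ℤ × G × ℤ} (h : x.1 ≤ i) :
    (warneMul θ u (i, 1, i) x).1 = i ∧
      (warneMul θ u (i, 1, i) x).2.2 = x.2.2 - x.1 + i := by
  simp [warneMul, h]

theorem warneMul_idem_right_of_ge {j : ℤ} {x : ℤ × G × ℤ} (h : x.2.2 ≤ j) :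
    (warneMul θ u x (j, 1, j)).1 = x.1 - x.2.2 + j ∧
      (warneMul θ u x (j, 1, j)).2.2 = j := by
  obtain h | h := eq_or_lt_of_le h
  · subst h; simp [warneMul]
  · simp [warneMul, not_le.mpr h]

theorem le_fst_warneMul_idem_left (i : ℤ) (x : ℤ × G × ℤ) :
    i ≤ (warneMul θ u (i, 1, i) x).1 := by
  obtain h | h := le_total i x.1
  · rwa [warneMul_idem_left_of_le h]
  · exact (warneMul_idem_left_of_ge h).1.ge

theorem le_snd_warneMul_idem_right (j : ℤ) (x : ℤ × G × ℤ) :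
    j ≤ (warneMul θ u x (j, 1, j)).2.2 := by
  obtain h | h := le_total j x.2.2
  · rwa [warneMul_idem_right_of_le h]
  · exact (warneMul_idem_right_of_ge h).2.ge

/-- The two-sided translation `g ↦ (i, 1, 0) · (0, g, 0) · (0, 1, j)`. -/
theorem warneMul_warneMul_zero (i j : ℤ) (g : G) :
    warneMul θ u (warneMul θ u (i, 1, 0) (0, g, 0)) (0, 1, j) = (i, g, j) := by
  simp [warneMul_of_eq]

theorem warneMul_warneMul_to_zero (i j : ℤ) (g : G) :
    warneMul θ u (warneMul θ u (0, 1, i) (i, g, j)) (j, 1, 0) = (0, g, 0) := by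
  simp [warneMul_of_eq]

theorem warneMul_idem_zero (hu : ∀ n : ℤ, 1 ≤ n → u n = 1) (m : ℕ) (g : G) :
    warneMul θ u ((m : ℤ), 1, (m : ℤ)) (0, g, 0) = ((m : ℤ), (θ ^ m) g, (m : ℤ)) := by
  simp [warneMul, warneF_eq_one hu]

section Semitopological

variable [t : TopologicalSpace (ℤ × G × ℤ)]

theorem isCompact_warne_component (hl : ∀ a : ℤ × G × ℤ, Continuous fun x => warneMul θ u a x)
    (hr : ∀ a : ℤ × G × ℤ, Continuous fun x => warneMul θ u x a)
    (hc : IsCompact {p : ℤ × G × ℤ | p.1 = 0 ∧ p.2.2 = 0}) (i j : ℤ) :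
    IsCompact {p : ℤ × G × ℤ | p.1 = i ∧ p.2.2 = j} := by
  convert! hc.image ((hr (0, 1, j)).comp (hl (i, 1, 0))) using 1
  ext ⟨a, g, b⟩
  simp only [mem_ofPred_eq, mem_image, Function.comp_apply]
  constructor
  · rintro ⟨rfl, rfl⟩
    exact ⟨(0, g, 0), ⟨rfl, rfl⟩, warneMul_warneMul_zero _ _ _⟩
  · rintro ⟨⟨_, h, _⟩, ⟨rfl, rfl⟩, hx⟩
    rw [warneMul_warneMul_zero] at hx
    cases hx
    exact ⟨rfl, rfl⟩

variable [T2Space (ℤ × G × ℤ)]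

theorem isOpen_warne_quadrant (hl : ∀ a : ℤ × G × ℤ, Continuous fun x => warneMul θ u a x)
    (hr : ∀ a : ℤ × G × ℤ, Continuous fun x => warneMul θ u x a) (i j : ℤ) :
    IsOpen {p : ℤ × G × ℤ | p.1 ≤ i ∧ p.2.2 ≤ j} := by
  have h₁ : IsClosed {p : ℤ × G × ℤ | i + 1 ≤ p.1} := by
    convert! isClosed_eq (hl (i + 1, 1, i + 1)) continuous_id using 1
    ext x
    exact ⟨fun h => warneMul_idem_left_of_le h,
      fun h => (le_fst_warneMul_idem_left _ _).trans_eq (congr_arg _ h)⟩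
  have h₂ : IsClosed {p : ℤ × G × ℤ | j + 1 ≤ p.2.2} := by
    convert! isClosed_eq (hr (j + 1, 1, j + 1)) continuous_id using 1
    ext x
    exact ⟨fun h => warneMul_idem_right_of_le h,
      fun h => (le_snd_warneMul_idem_right _ _).trans_eq (congr_arg (fun p => p.2.2) h)⟩
  convert! h₁.isOpen_compl.inter h₂.isOpen_compl using 1
  ext x
  simp only [mem_ofPred_eq, mem_inter_iff, mem_compl_iff]
  lia

theorem isOpen_warne_component (hl : ∀ a : ℤ × G × ℤ, Continuous fun x => warneMul θ u a x)
    (hr : ∀ a : ℤ × G × ℤ, Continuous fun x => warneMul θ u x a)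
    (hc : IsCompact {p : ℤ × G × ℤ | p.1 = 0 ∧ p.2.2 = 0}) (i j : ℤ) :
    IsOpen {p : ℤ × G × ℤ | p.1 = i ∧ p.2.2 = j} := by
  let F : ℤ × G × ℤ → ℤ × G × ℤ := fun x =>
    warneMul θ u (warneMul θ u (i - 1, 1, i - 1) x) (j - 1, 1, j - 1)
  have hF : Continuous F := (hr _).comp (hl _)
  have hclosed (k l : ℤ) : IsClosed {p : ℤ × G × ℤ | p.1 = k ∧ p.2.2 = l} :=
    (isCompact_warne_component hl hr hc k l).isClosed
  have hQ := isOpen_warne_quadrant hl hr i j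
  convert! ((hQ.inter (hQ.preimage hF)).inter
    ((hclosed (i - 1) (j - 1)).isOpen_compl.preimage hF)).inter
    (((hclosed (i - 1) j).isOpen_compl.preimage hF).inter
      ((hclosed i (j - 1)).isOpen_compl.preimage hF)) using 1
  ext x
  simp only [mem_inter_iff, mem_preimage, mem_ofPred_eq, mem_compl_iff]
  constructor
  · rintro ⟨rfl, rfl⟩
    have : F x = x := by
      simp only [F]
      rw [warneMul_idem_left_of_le (by lia), warneMul_idem_right_of_le (by lia)]
    rw [this]
    lia
  · rintro ⟨⟨⟨⟨hxi, hxj⟩, hFi, hFj⟩, h₁⟩, h₂, h₃⟩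
    set y := warneMul θ u (i - 1, 1, i - 1) x with hy
    have hyi := le_fst_warneMul_idem_left (θ := θ) (u := u) (i - 1) x
    have hFy : y.2.2 ≤ j - 1 ∧ (F x).2.2 = j - 1 ∧ (F x).1 = y.1 - y.2.2 + (j - 1) ∨
        j - 1 < y.2.2 ∧ F x = y := by
      obtain h | h := le_or_gt y.2.2 (j - 1)
      · exact .inl ⟨h, (warneMul_idem_right_of_ge h).2, (warneMul_idem_right_of_ge h).1⟩
      · exact .inr ⟨h, warneMul_idem_right_of_le h.le⟩
    have hyx : x.1 ≤ i - 1 ∧ y.1 = i - 1 ∧ y.2.2 = x.2.2 - x.1 + (i - 1) ∨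
        i - 1 < x.1 ∧ y = x := by
      obtain h | h := le_or_gt x.1 (i - 1)
      · exact .inl ⟨h, warneMul_idem_left_of_ge h⟩
      · exact .inr ⟨h, warneMul_idem_left_of_le h.le⟩
    change (F x).1 ≤ i at hFi
    rw [← hy] at hyi
    grind

/-- A Hausdorff topology with separately continuous multiplication and compact `G_{0,0}` is the
product topology. -/
theorem warne_topology_eq (hl : ∀ a : ℤ × G × ℤ, Continuous fun x => warneMul θ u a x)
    (hr : ∀ a : ℤ × G × ℤ, Continuous fun x => warneMul θ u x a)
    (hc : IsCompact {p : ℤ × G × ℤ | p.1 = 0 ∧ p.2.2 = 0}) :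
    t = @instTopologicalSpaceProd ℤ (G × ℤ) ⊥
        (@instTopologicalSpaceProd G ℤ
          (t.induced (fun g : G => ((0, g, 0) : ℤ × G × ℤ))) ⊥) := by
  let τ : TopologicalSpace G := t.induced (fun g : G => ((0, g, 0) : ℤ × G × ℤ))
  have hopen := isOpen_warne_component hl hr hc
  have hnhds (p : ℤ × G × ℤ) : ∀ᶠ q in @nhds _ t p, q.1 = p.1 ∧ q.2.2 = p.2.2 :=
    (hopen p.1 p.2.2).mem_nhds ⟨rfl, rfl⟩
  have h₁ : Continuous[t, ⊥] fun p : ℤ × G × ℤ => p.1 :=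
    @continuous_iff_continuousAt _ _ t ⊥ _ |>.mpr fun p =>
      @ContinuousAt.congr _ _ t ⊥ _ _ _ (@continuousAt_const _ _ t ⊥ p p.1)
        ((hnhds p).mono fun q hq => hq.1.symm)
  have h₂ : Continuous[t, ⊥] fun p : ℤ × G × ℤ => p.2.2 :=
    @continuous_iff_continuousAt _ _ t ⊥ _ |>.mpr fun p =>
      @ContinuousAt.congr _ _ t ⊥ _ _ _ (@continuousAt_const _ _ t ⊥ p p.2.2)
        ((hnhds p).mono fun q hq => hq.2.symm)
  have h₃ : Continuous[t, τ] fun p : ℤ × G × ℤ => p.2.1 := by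
    refine continuous_induced_rng.mpr ?_
    refine @continuous_iff_continuousAt _ _ t t _ |>.mpr fun p => ?_
    refine @ContinuousAt.congr _ _ t t _ _ _
      (@Continuous.continuousAt _ _ t t _ p ((hr (p.2.2, 1, 0)).comp (hl (0, 1, p.1)))) ?_
    refine (hnhds p).mono ?_
    rintro ⟨a, g, b⟩ ⟨rfl, rfl⟩
    exact warneMul_warneMul_to_zero _ _ _
  refine le_antisymm (le_inf (continuous_iff_le_induced.mp h₁) ?_) ?_
  · refine continuous_iff_le_induced.mp ?_
    exact @Continuous.prodMk _ _ _ τ ⊥ t _ _ h₃ h₂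
  · refine continuous_id_iff_le.mp ?_
    refine (@continuous_prod_of_discrete_left _ _ _ ⊥ _ t (discreteTopology_bot ℤ) _).mpr
      fun i => ?_
    refine (@continuous_prod_of_discrete_right _ _ _ τ ⊥ t (discreteTopology_bot ℤ) _).mpr
      fun j => ?_
    have : Continuous[τ, t] fun g : G => ((0, g, 0) : ℤ × G × ℤ) := continuous_induced_dom
    refine (((hr (0, 1, j)).comp (hl (i, 1, 0))).comp this).congr fun g => ?_
    exact warneMul_warneMul_zero _ _ _

end Semitopological

section ProductTopology

variable [TopologicalSpace G] [IsTopologicalGroup G]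

theorem continuous_warneMul (hθ : ∀ n : ℕ, Continuous (θ ^ n)) :
    Continuous fun p : (ℤ × G × ℤ) × (ℤ × G × ℤ) => warneMul θ u p.1 p.2 := by
  have key : Continuous fun r : ℤ × ℤ × ℤ × ℤ × G × G =>
      warneMul θ u (r.1, r.2.2.2.2.1, r.2.1) (r.2.2.1, r.2.2.2.2.2, r.2.2.2.1) := by
    refine continuous_prod_of_discrete_left.mpr fun a => ?_
    refine continuous_prod_of_discrete_left.mpr fun b => ?_
    refine continuous_prod_of_discrete_left.mpr fun c => ?_
    refine continuous_prod_of_discrete_left.mpr fun d => ?_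
    unfold warneMul
    by_cases h : c ≤ b
    · have := hθ (b - c).toNat
      simp only [h, if_true]
      fun_prop
    · have := hθ (c - b).toNat
      simp only [h, if_false]
      fun_prop
  exact key.comp (f := fun p : (ℤ × G × ℤ) × (ℤ × G × ℤ) =>
    (p.1.1, p.1.2.2, p.2.1, p.2.2.2, p.1.2.1, p.2.2.1)) (by fun_prop)

end ProductTopology

end Warne

/-- If `t` is a Hausdorff topology on the Warne semigroup `B_W` with separately
continuous multiplication and the maximal subgroup `G_{0,0}` is compact, then `t` is
the product topology (discrete ℤ's and `G` with the topology induced by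
`g ↦ (0,g,0)`), `(B_W, t)` is locally compact, its multiplication is jointly
continuous, and it admits a continuous inversion. -/
theorem warne_compact_subgroup {G : Type*} [Group G] (θ : Monoid.End G) (u : ℤ → G)
    (hu : ∀ n : ℤ, 1 ≤ n → u n = 1)
    (t : TopologicalSpace (ℤ × G × ℤ)) (ht2 : @T2Space _ t)
    (hl : ∀ a : ℤ × G × ℤ, @Continuous _ _ t t fun x => warneMul θ u a x)
    (hr : ∀ a : ℤ × G × ℤ, @Continuous _ _ t t fun x => warneMul θ u x a)
    (hc : @IsCompact _ t {p : ℤ × G × ℤ | p.1 = 0 ∧ p.2.2 = 0}) :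
    (t = @instTopologicalSpaceProd ℤ (G × ℤ) ⊥
        (@instTopologicalSpaceProd G ℤ
          (t.induced (fun g : G => ((0, g, 0) : ℤ × G × ℤ))) ⊥)) ∧
    @LocallyCompactSpace _ t ∧
    @Continuous _ _ (@instTopologicalSpaceProd _ _ t t) t
      (fun p : (ℤ × G × ℤ) × (ℤ × G × ℤ) => warneMul θ u p.1 p.2) ∧
    ∃ inv : ℤ × G × ℤ → ℤ × G × ℤ, @Continuous _ _ t t inv ∧
      ∀ x : ℤ × G × ℤ, warneMul θ u (warneMul θ u x (inv x)) x = x ∧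
        warneMul θ u (warneMul θ u (inv x) x) (inv x) = inv x := by
  let τ : TopologicalSpace G := t.induced (fun g : G => ((0, g, 0) : ℤ × G × ℤ))
  have hι : @IsEmbedding _ _ τ t fun g : G => ((0, g, 0) : ℤ × G × ℤ) :=
    @IsEmbedding.mk _ _ τ t _ (@IsInducing.mk _ _ τ t _ rfl)
      fun g h hgh => congr_arg (fun p : ℤ × G × ℤ => p.2.1) hgh
  have : T2Space G := @IsEmbedding.t2Space _ _ τ t ht2 _ hι
  have : CompactSpace G := by
    refine ⟨(@IsInducing.isCompact_iff _ _ τ t _ _ hι.toIsInducing).mpr ?_⟩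
    convert! hc using 1
    ext ⟨a, g, b⟩
    simp [eq_comm]
  have : SeparatelyContinuousMul G :=
    { continuous_const_mul := fun {g} => continuous_induced_rng.mpr <|
        ((hl (0, g, 0)).comp continuous_induced_dom).congr fun h => warneMul_of_eq _ _ _ _ _
      continuous_mul_const := fun {g} => continuous_induced_rng.mpr <|
        ((hr (0, g, 0)).comp continuous_induced_dom).congr fun h => warneMul_of_eq _ _ _ _ _ }
  have : IsTopologicalGroup G := isTopologicalGroup_of_compact_of_separatelyContinuousMul
  have hθ (n : ℕ) : Continuous (θ ^ n) := by
    refine continuous_induced_rng.mpr ?_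
    refine ((((hr (n, 1, 0)).comp (hl (0, 1, n))).comp (hl (n, 1, n))).comp
      continuous_induced_dom).congr fun g => ?_
    simp only [Function.comp_apply, warneMul_idem_zero hu, warneMul_warneMul_to_zero]
  have ht := warne_topology_eq hl hr hc
  refine ⟨ht, ?_⟩
  have key : ∀ s : TopologicalSpace (ℤ × G × ℤ), s = instTopologicalSpaceProd →
      @LocallyCompactSpace _ s ∧
      @Continuous _ _ (@instTopologicalSpaceProd _ _ s s) s
        (fun p : (ℤ × G × ℤ) × (ℤ × G × ℤ) => warneMul θ u p.1 p.2) ∧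
      ∃ inv : ℤ × G × ℤ → ℤ × G × ℤ, @Continuous _ _ s s inv ∧
        ∀ x : ℤ × G × ℤ, warneMul θ u (warneMul θ u x (inv x)) x = x ∧
          warneMul θ u (warneMul θ u (inv x) x) (inv x) = inv x := by
    rintro _ rfl
    refine ⟨inferInstance, continuous_warneMul hθ, fun x => (x.2.2, x.2.1⁻¹, x.1),
      by fun_prop, ?_⟩
    rintro ⟨a, g, b⟩
    simp [warneMul_of_eq]
  exact key t ht
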